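/- Let (e_n)_{n∈ℕ} be the standard orthonormal basis of ℓ²(ℕ) and let X be the Banach space (under the operator norm) of all compact operators T on ℓ²(ℕ) whose matrix is triangular with respect to (e_n), i.e. ⟨T e_n, e_m⟩ = 0 whenever m > n. Then X admits no framing: there exist no sequences (x_i)_{i∈ℕ} in X and (y_i)_{i∈ℕ} in X* such that for every T ∈ X the family (y_i(T)·x_i)_{i∈ℕ} is summable with sum T. -/

import Mathlib

noncomputable section

open scoped ENNReal

/-- `ℓ²(ℕ)` with complex scalars. -/
abbrev ellTwo : Type := lp (fun _ : ℕ => ℂ) 2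

/-- The standard orthonormal basis of `ℓ²(ℕ)`. -/
def stdBasis (n : ℕ) : ellTwo := lp.single 2 n 1

/-- The space `X` of all compact operators on `ℓ²(ℕ)` whose matrix is (lower)
triangular with respect to the standard orthonormal basis, i.e.
`⟨T eₙ, eₘ⟩ = 0` whenever `m > n`.  It is a linear subspace of the bounded
operators, carrying the operator norm. -/
def TriangularCompact : Submodule ℂ (ellTwo →L[ℂ] ellTwo) where
  carrier := {T | IsCompactOperator T ∧ ∀ n m : ℕ, n < m → (T (stdBasis n)) m = 0}
  add_mem' := by
    rintro T S ⟨hTc, hTt⟩ ⟨hSc, hSt⟩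
    refine ⟨hTc.add hSc, fun n m h => ?_⟩
    have := hTt n m h
    have := hSt n m h
    simp_all [ContinuousLinearMap.add_apply]
  zero_mem' := by
    refine ⟨isCompactOperator_zero, fun n m h => ?_⟩
    simp
  smul_mem' := by
    rintro c T ⟨hTc, hTt⟩
    refine ⟨hTc.smul c, fun n m h => ?_⟩
    have := hTt n m h
    simp_all [ContinuousLinearMap.smul_apply]

/-- The sign `1` or `-1` encoded by a boolean. -/
def boolSign (s : Bool) : ℂ := if s then 1 else -1

lemma norm_boolSign (s : Bool) : ‖boolSign s‖ = 1 := by cases s <;> simp [boolSign]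

section Khintchine
variable {E : Type*} [NormedAddCommGroup E] [InnerProductSpace ℂ E]

lemma sum_signs_succ {n : ℕ} (h : Fin (n + 1) → E) (f : E → ℝ) :
    ∑ s : Fin (n + 1) → Bool, f (∑ a, boolSign (s a) • h a) =
      ∑ s : Fin n → Bool, (f ((∑ a, boolSign (s a) • h a.succ) + h 0) +
        f ((∑ a, boolSign (s a) • h a.succ) - h 0)) := by
  rw [← (Fin.consEquiv fun _ : Fin (n + 1) => Bool).sum_comp, Fintype.sum_prod_type,
    Finset.sum_comm]
  simp [Fin.consEquiv, Fin.sum_univ_succ, boolSign, add_comm, sub_eq_add_neg]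

lemma sum_signs_norm_sq {n : ℕ} (h : Fin n → E) :
    ∑ s : Fin n → Bool, ‖∑ a, boolSign (s a) • h a‖ ^ 2 = 2 ^ n * ∑ a, ‖h a‖ ^ 2 := by
  induction n with
  | zero => simp
  | succ n ih =>
    rw [sum_signs_succ h fun v => ‖v‖ ^ 2]
    have key (u v : E) : ‖u + v‖ ^ 2 + ‖u - v‖ ^ 2 = 2 * ‖u‖ ^ 2 + 2 * ‖v‖ ^ 2 := by
      rw [@norm_add_sq ℂ, @norm_sub_sq ℂ]; ring
    simp only [key, Finset.sum_add_distrib, ← Finset.mul_sum, ih, Fin.sum_univ_succ]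
    simp
    ring

lemma sum_signs_norm_pow_four_le {n : ℕ} (h : Fin n → E) :
    ∑ s : Fin n → Bool, ‖∑ a, boolSign (s a) • h a‖ ^ 4 ≤
      3 * 2 ^ n * (∑ a, ‖h a‖ ^ 2) ^ 2 := by
  induction n with
  | zero => simp
  | succ n ih =>
    rw [sum_signs_succ h fun v => ‖v‖ ^ 4]
    have key (u v : E) : ‖u + v‖ ^ 4 + ‖u - v‖ ^ 4 ≤
        2 * ‖u‖ ^ 4 + 12 * ‖v‖ ^ 2 * ‖u‖ ^ 2 + 2 * ‖v‖ ^ 4 := by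
      have h1 : ‖u + v‖ ^ 4 = (‖u + v‖ ^ 2) ^ 2 := by ring
      have h2 : ‖u - v‖ ^ 4 = (‖u - v‖ ^ 2) ^ 2 := by ring
      rw [h1, h2, @norm_add_sq ℂ, @norm_sub_sq ℂ]
      have h3 : RCLike.re (inner ℂ u v) ^ 2 ≤ (‖u‖ * ‖v‖) ^ 2 := by
        rw [← sq_abs]
        gcongr
        exact (RCLike.abs_re_le_norm _).trans (norm_inner_le_norm u v)
      nlinarith [h3]
    refine (Finset.sum_le_sum fun s _ => key _ _).trans ?_
    simp only [Finset.sum_add_distrib, ← Finset.mul_sum, sum_signs_norm_sq]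
    have := ih fun a => h a.succ
    rw [Fin.sum_univ_succ]
    simp only [Finset.sum_const, Finset.card_univ, Fintype.card_pi, Fintype.card_bool,
      Finset.prod_const, Fintype.card_fin, nsmul_eq_mul]
    push_cast
    have h4 : (0 : ℝ) ≤ 2 ^ n * ‖h 0‖ ^ 4 := by positivity
    rw [pow_succ (2 : ℝ) n]
    nlinarith [this, h4]

/-- The first moment Khintchine inequality for vectors of an inner product space. -/
lemma khintchine {n : ℕ} (h : Fin n → E) :
    2 ^ n * √(∑ a, ‖h a‖ ^ 2) ≤ 2 * ∑ s : Fin n → Bool, ‖∑ a, boolSign (s a) • h a‖ := by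
  have h2 := sum_signs_norm_sq h
  have h4 := sum_signs_norm_pow_four_le h
  have hs : √(∑ a, ‖h a‖ ^ 2) ^ 2 = ∑ a, ‖h a‖ ^ 2 := Real.sq_sqrt (by positivity)
  rw [← hs] at h2 h4
  set σ := √(∑ a, ‖h a‖ ^ 2)
  have hσ : 0 ≤ σ := Real.sqrt_nonneg _
  rcases hσ.eq_or_lt with h0 | h0
  · rw [← h0, mul_zero]; positivity
  have key (t : ℝ) (ht : 0 ≤ t) : 12 * σ ^ 2 * t ^ 2 ≤ t ^ 4 + 16 * σ ^ 3 * t := by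
    have : 0 ≤ t * (t - 2 * σ) ^ 2 * (t + 4 * σ) := by positivity
    linarith [this]
  have := Finset.sum_le_sum fun (s : Fin n → Bool) (_ : s ∈ Finset.univ) =>
    key ‖∑ a, boolSign (s a) • h a‖ (norm_nonneg _)
  rw [Finset.sum_add_distrib, ← Finset.mul_sum, ← Finset.mul_sum, h2] at this
  have h5 : σ ^ 3 * (9 * (2 ^ n * σ)) ≤
      σ ^ 3 * (16 * ∑ s : Fin n → Bool, ‖∑ a, boolSign (s a) • h a‖) := by
    linarith [this, h4]
  have h6 := le_of_mul_le_mul_left h5 (by positivity)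
  have : 0 ≤ 2 ^ n * σ := by positivity
  linarith

end Khintchine

/-- Khintchine's inequality for products of two independent families of signs. -/
lemma khintchine_bilinear {n : ℕ} (z : Fin n → Fin n → ℂ) :
    (2 ^ n * 2 ^ n) * √(∑ a, ∑ b, ‖z a b‖ ^ 2) ≤
      4 * ∑ p : (Fin n → Bool) × (Fin n → Bool),
        ‖∑ a, ∑ b, boolSign (p.1 a) * boolSign (p.2 b) * z a b‖ := by
  rw [Fintype.sum_prod_type_right]
  have h1 := khintchine fun b => WithLp.toLp 2 (fun a => z a b)
  have e1 : ∑ b, ‖WithLp.toLp 2 (fun a => z a b)‖ ^ 2 = ∑ a, ∑ b, ‖z a b‖ ^ 2 := by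
    rw [Finset.sum_comm]
    simp [EuclideanSpace.norm_sq_eq]
  rw [e1] at h1
  have h2 (t : Fin n → Bool) : 2 ^ n * ‖∑ b, boolSign (t b) • WithLp.toLp 2 (fun a => z a b)‖ ≤
      2 * ∑ s : Fin n → Bool, ‖∑ a, ∑ b, boolSign (s a) * boolSign (t b) * z a b‖ := by
    rw [EuclideanSpace.norm_eq]
    refine (khintchine _).trans_eq ?_
    simp [Finset.mul_sum, mul_assoc]
  have h3 := Finset.sum_le_sum fun t (_ : t ∈ Finset.univ) => h2 t
  rw [← Finset.mul_sum, ← Finset.mul_sum] at h3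
  have : (0 : ℝ) < 2 ^ n := by positivity
  nlinarith [mul_le_mul_of_nonneg_left h1 this.le, h3]

/-- The Fourier matrix has unimodular entries and is a multiple of an isometry. -/
lemma exists_flat_isometry (n : ℕ) [NeZero n] : ∃ F : Fin n → Fin n → ℂ,
    (∀ a b, ‖F a b‖ = 1) ∧
      ∀ v : Fin n → ℂ, ∑ a, ‖∑ b, F a b * v b‖ ^ 2 = n * ∑ b, ‖v b‖ ^ 2 := by
  let e : ZMod n ≃ Fin n := (ZMod.finEquiv n).toEquiv.symm
  let ψ := ZMod.stdAddChar (N := n)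
  refine ⟨fun a b => ψ (e.symm a * e.symm b), fun a b => ψ.norm_apply _, fun v => ?_⟩
  have key : ∑ x : ZMod n, ‖∑ y : ZMod n, ψ (x * y) * v (e y)‖ ^ 2 =
      n * ∑ y : ZMod n, ‖v (e y)‖ ^ 2 := by
    apply Complex.ofReal_injective
    push_cast
    simp only [← Complex.conj_mul', map_sum, map_mul, Finset.sum_mul_sum]
    rw [Finset.sum_comm, Finset.mul_sum]
    refine Finset.sum_congr rfl fun y _ => ?_
    rw [Finset.sum_comm]
    have h (y' : ZMod n) : ∑ x, (starRingEnd ℂ) (ψ (x * y)) * (starRingEnd ℂ) (v (e y)) *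
        (ψ (x * y') * v (e y')) =
        (∑ x, ψ (x * (y' - y))) * ((starRingEnd ℂ) (v (e y)) * v (e y')) := by
      rw [Finset.sum_mul]
      refine Finset.sum_congr rfl fun x _ => ?_
      rw [mul_sub, sub_eq_add_neg, AddChar.map_add_eq_mul, AddChar.map_neg_eq_conj]
      ring
    simp only [h]
    have h' (z : ZMod n) : ∑ x, ψ (x * z) = if z = 0 then (n : ℂ) else 0 := by
      simpa using AddChar.sum_mulShift z (ZMod.isPrimitive_stdAddChar n)
    simp [h', sub_eq_zero]
  rw [← e.sum_comp, ← e.sum_comp (fun b => ‖v b‖ ^ 2), ← key]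
  refine Finset.sum_congr rfl fun x _ => ?_
  rw [← e.sum_comp]
  simp

/-- A finite family with uniformly bounded subsums is bounded in `ℓ¹`. -/
lemma sum_norm_le_of_subsums {ι : Type*} (F : Finset ι) (c : ι → ℂ) {M : ℝ}
    (h : ∀ G : Finset ι, ‖∑ i ∈ G, c i‖ ≤ M) : ∑ i ∈ F, ‖c i‖ ≤ 4 * M := by
  have key (r : ι → ℝ) (hr : ∀ G : Finset ι, |∑ i ∈ G, r i| ≤ M) : ∑ i ∈ F, |r i| ≤ 2 * M := by
    classical
    rw [← Finset.sum_filter_add_sum_filter_not F (fun i => 0 ≤ r i)]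
    have h1 : ∑ i ∈ F with 0 ≤ r i, |r i| = ∑ i ∈ F with 0 ≤ r i, r i :=
      Finset.sum_congr rfl fun i hi => abs_of_nonneg (Finset.mem_filter.1 hi).2
    have h2 : ∑ i ∈ F with ¬ 0 ≤ r i, |r i| = -∑ i ∈ F with ¬ 0 ≤ r i, r i := by
      rw [← Finset.sum_neg_distrib]
      exact Finset.sum_congr rfl fun i hi =>
        abs_of_neg (not_le.1 (Finset.mem_filter.1 hi).2)
    rw [h1, h2]
    linarith [(abs_le.1 (hr {i ∈ F | 0 ≤ r i})).2, (abs_le.1 (hr {i ∈ F | ¬ 0 ≤ r i})).1]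
  have hre := key (fun i => (c i).re) fun G => by
    rw [← Complex.re_sum]; exact (Complex.abs_re_le_norm _).trans (h G)
  have him := key (fun i => (c i).im) fun G => by
    rw [← Complex.im_sum]; exact (Complex.abs_im_le_norm _).trans (h G)
  have := Finset.sum_le_sum fun i (_ : i ∈ F) => Complex.norm_le_abs_re_add_abs_im (c i)
  rw [Finset.sum_add_distrib] at this
  linarith
/-- Uniform boundedness of the partial sums of a framing. -/
lemma exists_bound_of_framing {X : Type*} [NormedAddCommGroup X] [NormedSpace ℂ X]
    [CompleteSpace X] {x : ℕ → X} {y : ℕ → X →L[ℂ] ℂ}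
    (h : ∀ T, HasSum (fun i => y i T • x i) T) :
    ∃ C, 0 ≤ C ∧ ∀ (G : Finset ℕ) (T : X), ‖∑ i ∈ G, y i T • x i‖ ≤ C * ‖T‖ := by
  let S (G : Finset ℕ) : X →L[ℂ] X := ∑ i ∈ G, (y i).smulRight (x i)
  have hS (G : Finset ℕ) (T : X) : S G T = ∑ i ∈ G, y i T • x i := by
    simp [S]
  obtain ⟨C, hC⟩ := banach_steinhaus (g := S) fun T => by
    obtain ⟨s, hs⟩ := summable_iff_vanishing_norm.1 (h T).summable 1 one_pos
    refine ⟨∑ i ∈ s, ‖y i T • x i‖ + 1, fun G => ?_⟩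
    rw [hS, ← Finset.sum_inter_add_sum_sdiff G s]
    refine (norm_add_le _ _).trans (add_le_add ?_ (hs _ Finset.sdiff_disjoint).le)
    exact (norm_sum_le _ _).trans
      (Finset.sum_le_sum_of_subset_of_nonneg Finset.inter_subset_right fun _ _ _ => norm_nonneg _)
  exact ⟨C, (norm_nonneg _).trans (hC ∅), fun G T => by rw [← hS]; exact (S G).le_of_opNorm_le (hC G) T⟩

/-- Absolute summability of `y i T * φ (x i)` with a bound uniform in `T` and `φ`. -/
lemma sum_norm_mul_norm_le {X : Type*} [NormedAddCommGroup X] [NormedSpace ℂ X]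
    {x : ℕ → X} {y : ℕ → X →L[ℂ] ℂ} {C : ℝ}
    (hC : ∀ (G : Finset ℕ) (T : X), ‖∑ i ∈ G, y i T • x i‖ ≤ C * ‖T‖)
    (φ : X →L[ℂ] ℂ) {L : ℝ} (hL : 0 ≤ L) (hφ : ∀ T, ‖φ T‖ ≤ L * ‖T‖) (T : X) (F : Finset ℕ) :
    ∑ i ∈ F, ‖y i T‖ * ‖φ (x i)‖ ≤ 4 * (L * (C * ‖T‖)) := by
  simp only [← norm_mul]
  refine sum_norm_le_of_subsums F _ fun G => ?_
  have : ∑ i ∈ G, y i T * φ (x i) = φ (∑ i ∈ G, y i T • x i) := by simp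
  rw [this]
  exact (hφ _).trans (mul_le_mul_of_nonneg_left (hC G T) hL)

lemma norm_sum_sum_mul_le {ι κ : Type*} [Fintype ι] [Fintype κ] (u v : ι → κ → ℂ) :
    ‖∑ a, ∑ b, u a b * v a b‖ ≤ √(∑ a, ∑ b, ‖u a b‖ ^ 2) * √(∑ a, ∑ b, ‖v a b‖ ^ 2) := by
  simp only [← Fintype.sum_prod_type']
  refine (norm_sum_le _ _).trans ?_
  simp only [norm_mul]
  exact Real.sum_mul_le_sqrt_mul_sqrt _ _ _

/-- If `n × n` matrices with the operator norm embed in `X`, with rank one functionals on them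
extending to `X`, then the trace of a framing on these matrices is of order at most `n * √n`. -/
lemma sum_norm_block_trace_le {X : Type*} [NormedAddCommGroup X] [NormedSpace ℂ X]
    {x : ℕ → X} {y : ℕ → X →L[ℂ] ℂ} {C : ℝ} (hC0 : 0 ≤ C)
    (hC : ∀ (G : Finset ℕ) (T : X), ‖∑ i ∈ G, y i T • x i‖ ≤ C * ‖T‖)
    {n : ℕ} [NeZero n] (U : Fin n → Fin n → X) (e : Fin n → Fin n → X →L[ℂ] ℂ)
    (hU : ∀ (z : Fin n → Fin n → ℂ) (K : ℝ), 0 ≤ K →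
      (∀ v : Fin n → ℂ, ∑ a, ‖∑ b, z a b * v b‖ ^ 2 ≤ K ^ 2 * ∑ b, ‖v b‖ ^ 2) →
      ‖∑ a, ∑ b, z a b • U a b‖ ≤ K)
    (he : ∀ s t : Fin n → ℂ, (∀ a, ‖s a‖ = 1) → (∀ b, ‖t b‖ = 1) →
      ∀ T, ‖∑ a, ∑ b, s a * t b * e a b T‖ ≤ n * ‖T‖)
    (F : Finset ℕ) :
    ∑ i ∈ F, ‖∑ a, ∑ b, y i (U a b) * e a b (x i)‖ ≤ 64 * C * n * √n := by
  obtain ⟨W, hW, hW'⟩ := exists_flat_isometry n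
  let J (p : (Fin n → Bool) × (Fin n → Bool)) : X :=
    ∑ a, ∑ b, (boolSign (p.1 a) * boolSign (p.2 b) * W a b) • U a b
  let φ (p : (Fin n → Bool) × (Fin n → Bool)) : X →L[ℂ] ℂ :=
    ∑ a, ∑ b, (boolSign (p.1 a) * boolSign (p.2 b)) • e a b
  have hJ (p) : ‖J p‖ ≤ √n := by
    refine hU _ _ (Real.sqrt_nonneg _) fun v => ?_
    rw [Real.sq_sqrt (Nat.cast_nonneg n)]
    have h1 (a : Fin n) : ‖∑ b, boolSign (p.1 a) * boolSign (p.2 b) * W a b * v b‖ =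
        ‖∑ b, W a b * (boolSign (p.2 b) * v b)‖ := by
      rw [← one_mul ‖∑ b, W a b * (boolSign (p.2 b) * v b)‖, ← norm_boolSign (p.1 a),
        ← norm_mul, Finset.mul_sum]
      congr 1
      exact Finset.sum_congr rfl fun b _ => by ring
    simp only [h1, hW', norm_mul, norm_boolSign, one_mul, le_refl]
  have hφ (p) (T : X) : ‖φ p T‖ ≤ n * ‖T‖ := by
    have := he (fun a => boolSign (p.1 a)) (fun b => boolSign (p.2 b))
      (fun _ => norm_boolSign _) (fun _ => norm_boolSign _) T
    simpa [φ] using this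
  set M : ℝ := 2 ^ n * 2 ^ n
  have hM : 0 < M := by positivity
  have hy (i) : M * √(∑ a : Fin n, ∑ b : Fin n, ‖y i (U a b)‖ ^ 2) ≤
      4 * ∑ p, ‖y i (J p)‖ := by
    have := khintchine_bilinear fun a b => W a b * y i (U a b)
    simpa [J, M, hW, mul_assoc] using this
  have hx (i) : M * √(∑ a : Fin n, ∑ b : Fin n, ‖e a b (x i)‖ ^ 2) ≤
      4 * ∑ q, ‖φ q (x i)‖ := by
    have := khintchine_bilinear fun a b : Fin n => e a b (x i)
    simpa [φ, M, mul_assoc] using this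
  have hterm (i) :
      M ^ 2 * ‖∑ a : Fin n, ∑ b : Fin n, y i (U a b) * e a b (x i)‖ ≤
        16 * ∑ p, ∑ q, ‖y i (J p)‖ * ‖φ q (x i)‖ := by
    rw [← Finset.sum_mul_sum]
    refine (mul_le_mul_of_nonneg_left (norm_sum_sum_mul_le _ _) (by positivity)).trans ?_
    have := mul_le_mul (hy i) (hx i) (by positivity) (by positivity)
    linarith [this]
  have hpq (p q) : ∑ i ∈ F, ‖y i (J p)‖ * ‖φ q (x i)‖ ≤ 4 * (n * (C * √n)) := by
    refine (sum_norm_mul_norm_le hC (φ q) (Nat.cast_nonneg n) (hφ q) (J p) F).trans ?_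
    have := mul_le_mul_of_nonneg_left (hJ p) (by positivity : 0 ≤ 4 * (n * C))
    linarith [this]
  have hsum := Finset.sum_le_sum fun i (_ : i ∈ F) => hterm i
  rw [← Finset.mul_sum, ← Finset.mul_sum, Finset.sum_comm] at hsum
  have hsum' : ∑ p, ∑ i ∈ F, ∑ q, ‖y i (J p)‖ * ‖φ q (x i)‖ ≤ M ^ 2 * (4 * (n * (C * √n))) := by
    calc _ ≤ ∑ _p : (Fin n → Bool) × (Fin n → Bool), ∑ _q : (Fin n → Bool) × (Fin n → Bool),
          4 * (n * (C * √n)) := by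
          refine Finset.sum_le_sum fun p _ => ?_
          rw [Finset.sum_comm]
          exact Finset.sum_le_sum fun q _ => hpq p q
      _ = M ^ 2 * (4 * (n * (C * √n))) := by
          simp [M]
          ring
  refine le_of_mul_le_mul_left ?_ (by positivity : 0 < M ^ 2)
  linarith [hsum, hsum']

lemma sq_le_of_framing {X : Type*} [NormedAddCommGroup X] [NormedSpace ℂ X]
    {x : ℕ → X} {y : ℕ → X →L[ℂ] ℂ} (h : ∀ T, HasSum (fun i => y i T • x i) T)
    {B : ℝ} {n : ℕ} (U : Fin n → Fin n → X) (e : Fin n → Fin n → X →L[ℂ] ℂ)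
    (hUe : ∀ a b, e a b (U a b) = 1)
    (hB : ∀ F : Finset ℕ, ∑ i ∈ F, ‖∑ a, ∑ b, y i (U a b) * e a b (x i)‖ ≤ B) :
    (n : ℝ) ^ 2 ≤ B := by
  have h1 : HasSum (fun i => ∑ a, ∑ b, y i (U a b) * e a b (x i)) ((n : ℂ) ^ 2) := by
    have h2 : (n : ℂ) ^ 2 = ∑ a, ∑ b, e a b (U a b) := by simp [hUe, sq]
    rw [h2]
    refine hasSum_sum fun a _ => hasSum_sum fun b _ => ?_
    simpa using (e a b).hasSum (h (U a b))
  have h3 := le_of_tendsto h1.norm (Filter.Eventually.of_forall fun F =>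
    (norm_sum_le F _).trans (hB F))
  simpa using h3

/-- A Banach space containing uniformly the spaces of `n × n` matrices with the operator norm,
complemented so that the rank one functionals extend, has no framing. -/
lemma not_framing_of_blocks {X : Type*} [NormedAddCommGroup X] [NormedSpace ℂ X]
    [CompleteSpace X] (U : ∀ n, Fin n → Fin n → X) (e : ∀ n, Fin n → Fin n → X →L[ℂ] ℂ)
    (hUe : ∀ n a b, e n a b (U n a b) = 1)
    (hU : ∀ (n : ℕ) (z : Fin n → Fin n → ℂ) (K : ℝ), 0 ≤ K →
      (∀ v : Fin n → ℂ, ∑ a, ‖∑ b, z a b * v b‖ ^ 2 ≤ K ^ 2 * ∑ b, ‖v b‖ ^ 2) →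
      ‖∑ a, ∑ b, z a b • U n a b‖ ≤ K)
    (he : ∀ (n : ℕ) (s t : Fin n → ℂ), (∀ a, ‖s a‖ = 1) → (∀ b, ‖t b‖ = 1) →
      ∀ T, ‖∑ a, ∑ b, s a * t b * e n a b T‖ ≤ n * ‖T‖)
    (x : ℕ → X) (y : ℕ → X →L[ℂ] ℂ) : ¬ ∀ T, HasSum (fun i => y i T • x i) T := by
  intro h
  obtain ⟨C, hC0, hC⟩ := exists_bound_of_framing h
  have key (n : ℕ) [NeZero n] : (n : ℝ) ^ 2 ≤ 64 * C * n * √n :=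
    sq_le_of_framing h (U n) (e n) (hUe n)
      (sum_norm_block_trace_le hC0 hC (U n) (e n) (hU n) (he n))
  obtain ⟨m, hm⟩ := exists_nat_gt (64 * C)
  have hm0 : (0 : ℝ) < m := lt_of_le_of_lt (by positivity) hm
  have : NeZero (m ^ 2) := ⟨pow_ne_zero _ (by rintro rfl; simp at hm0)⟩
  have h4 := key (m ^ 2)
  push_cast at h4
  rw [Real.sqrt_sq hm0.le] at h4
  have h5 : (m : ℝ) ^ 3 * m ≤ m ^ 3 * (64 * C) := by linarith [h4]
  exact absurd (le_of_mul_le_mul_left h5 (by positivity)) (not_le.2 hm)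

lemma evalCLM_apply (m : ℕ) (v : ellTwo) : lp.evalCLM ℂ (fun _ : ℕ => ℂ) 2 m v = v m := rfl

lemma isClosed_triangularCompact : IsClosed (TriangularCompact : Set (ellTwo →L[ℂ] ellTwo)) := by
  have h : (TriangularCompact : Set (ellTwo →L[ℂ] ellTwo)) =
      {T : ellTwo →L[ℂ] ellTwo | IsCompactOperator T} ∩
        ⋂ (n : ℕ) (m : ℕ) (_ : n < m),
          {T : ellTwo →L[ℂ] ellTwo | lp.evalCLM ℂ (fun _ : ℕ => ℂ) 2 m (T (stdBasis n)) = 0} := by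
    ext T
    simp [TriangularCompact, evalCLM_apply]
  rw [h]
  refine isClosed_setOfPred_isCompactOperator.inter ?_
  refine isClosed_iInter fun n => isClosed_iInter fun m => isClosed_iInter fun _ => ?_
  exact isClosed_eq (by fun_prop) continuous_const

instance : CompleteSpace TriangularCompact :=
  isClosed_triangularCompact.completeSpace_coe

/-- The matrix unit with its entry `1` in row `a` and column `n + b`. -/
def upperUnit {n : ℕ} (a b : Fin n) : TriangularCompact where
  val := (lp.evalCLM ℂ (fun _ : ℕ => ℂ) 2 (n + b)).smulRight (stdBasis a)
  property := by
    refine ⟨?_, fun k m hkm => ?_⟩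
    · exact (isCompactOperator_of_locallyCompactSpace_rng _ : IsCompactOperator
        (ContinuousLinearMap.toSpanSingleton ℂ (stdBasis a))).comp_clm
          (lp.evalCLM ℂ (fun _ : ℕ => ℂ) 2 (n + b))
    · have := a.isLt
      by_cases h : n + (b : ℕ) = k
      · simp [stdBasis, lp.single_apply, show m ≠ a by omega]
      · simp [evalCLM_apply, stdBasis, lp.single_apply, h]

lemma upperUnit_apply {n : ℕ} (a b : Fin n) (v : ellTwo) :
    (upperUnit a b).1 v = v (n + b) • stdBasis a := rfl

/-- The entry of `T` in row `a` and column `n + b`. -/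
def upperEntry {n : ℕ} (a b : Fin n) : TriangularCompact →L[ℂ] ℂ :=
  (lp.evalCLM ℂ (fun _ : ℕ => ℂ) 2 a).comp
    ((ContinuousLinearMap.apply ℂ ellTwo (stdBasis (n + b))).comp TriangularCompact.subtypeL)

lemma upperEntry_apply {n : ℕ} (a b : Fin n) (T : TriangularCompact) :
    upperEntry a b T = T.1 (stdBasis (n + b)) a := rfl

lemma upperEntry_upperUnit {n : ℕ} (a b : Fin n) : upperEntry a b (upperUnit a b) = 1 := by
  simp [upperEntry_apply, upperUnit_apply, stdBasis]

lemma sum_norm_sq_le {ι : Type*} [Fintype ι] {f : ι → ℕ} (hf : Function.Injective f)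
    (v : ellTwo) : ∑ i, ‖v (f i)‖ ^ 2 ≤ ‖v‖ ^ 2 := by
  have := lp.sum_rpow_le_norm_rpow (p := 2) (by simp) v (Finset.univ.map ⟨f, hf⟩)
  simpa using this

lemma norm_sum_smul_stdBasis_sq {ι : Type*} [Fintype ι] {f : ι → ℕ} (hf : Function.Injective f)
    (c : ι → ℂ) : ‖∑ i, c i • stdBasis (f i)‖ ^ 2 = ∑ i, ‖c i‖ ^ 2 := by
  have ho : Orthonormal ℂ stdBasis := by
    rw [orthonormal_iff_ite]
    intro i j
    simp [stdBasis, lp.inner_single_left, lp.single_apply, Pi.single_apply]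
  have h1 := (ho.comp f hf).inner_sum c c Finset.univ
  rw [inner_self_eq_norm_sq_to_K] at h1
  apply Complex.ofReal_injective
  simpa [← Complex.conj_mul'] using h1

lemma norm_upper_block_le {n : ℕ} (z : Fin n → Fin n → ℂ) {K : ℝ} (hK : 0 ≤ K)
    (hz : ∀ v : Fin n → ℂ, ∑ a, ‖∑ b, z a b * v b‖ ^ 2 ≤ K ^ 2 * ∑ b, ‖v b‖ ^ 2) :
    ‖∑ a, ∑ b, z a b • upperUnit a b‖ ≤ K := by
  refine ContinuousLinearMap.opNorm_le_bound _ hK fun v => ?_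
  have h1 : (∑ a, ∑ b, z a b • upperUnit a b : TriangularCompact).1 v =
      ∑ a, (∑ b, z a b * v (n + b)) • stdBasis (a : ℕ) := by
    simp [upperUnit_apply, Finset.sum_smul, mul_smul]
  change ‖(∑ a, ∑ b, z a b • upperUnit a b : TriangularCompact).1 v‖ ≤ _
  rw [h1]
  apply le_of_sq_le_sq _ (by positivity)
  rw [norm_sum_smul_stdBasis_sq Fin.val_injective, mul_pow]
  refine (hz _).trans ?_
  gcongr
  exact sum_norm_sq_le (f := fun b : Fin n => n + (b : ℕ))
    (fun b c h => Fin.ext (Nat.add_left_cancel h)) v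

lemma norm_sum_upperEntry_le {n : ℕ} (s t : Fin n → ℂ) (hs : ∀ a, ‖s a‖ = 1)
    (ht : ∀ b, ‖t b‖ = 1) (T : TriangularCompact) :
    ‖∑ a, ∑ b, s a * t b * upperEntry a b T‖ ≤ n * ‖T‖ := by
  set w : ellTwo := ∑ b, t b • stdBasis (n + (b : Fin n))
  have hw : ‖w‖ ^ 2 = n := by
    rw [norm_sum_smul_stdBasis_sq (f := fun b : Fin n => n + (b : ℕ))
      (fun b c h => Fin.ext (Nat.add_left_cancel h))]
    simp [ht]
  have h1 : ∑ a, ∑ b, s a * t b * upperEntry a b T = ∑ a : Fin n, s a * (T.1 w) a := by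
    have h0 (a : Fin n) : (T.1 w) a = ∑ b, t b * upperEntry a b T := by
      rw [← evalCLM_apply]
      simp [w, evalCLM_apply, upperEntry_apply]
    simp only [h0, Finset.mul_sum, mul_assoc]
  have h2 : ‖∑ a : Fin n, s a * (T.1 w) a‖ ≤ ∑ a : Fin n, ‖(T.1 w) a‖ := by
    refine (norm_sum_le _ _).trans_eq ?_
    simp [hs]
  rw [h1]
  refine h2.trans ?_
  apply le_of_sq_le_sq _ (by positivity)
  calc (∑ a : Fin n, ‖(T.1 w) a‖) ^ 2 ≤ n * ∑ a : Fin n, ‖(T.1 w) a‖ ^ 2 := by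
        simpa using sq_sum_le_card_mul_sum_sq (s := Finset.univ) (f := fun a : Fin n => ‖(T.1 w) a‖)
    _ ≤ n * (‖T‖ * ‖w‖) ^ 2 := by
        gcongr
        refine (sum_norm_sq_le Fin.val_injective _).trans ?_
        gcongr
        exact T.1.le_opNorm w
    _ = (n * ‖T‖) ^ 2 := by rw [mul_pow, mul_pow, hw]; ring

/-- **A Banach space with no framing** (Gordon–Lewis space of triangular compact
operators).  The space `X` of compact operators on `ℓ²(ℕ)` that are triangular with
respect to the standard orthonormal basis admits no framing: there are no sequences
`(xᵢ)` in `X` and `(yᵢ)` in `X*` such that every `T ∈ X` satisfies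
`T = ∑ᵢ yᵢ(T) xᵢ` unconditionally. -/
theorem no_framing_for_triangular_compact_operators :
    ¬ ∃ (x : ℕ → TriangularCompact) (y : ℕ → (TriangularCompact →L[ℂ] ℂ)),
        ∀ T : TriangularCompact, HasSum (fun i : ℕ => y i T • x i) T := by
  rintro ⟨x, y, h⟩
  refine not_framing_of_blocks (fun _ => upperUnit) (fun _ => upperEntry)
    (fun _ => upperEntry_upperUnit) (fun n z K hK hz => ?_)
    (fun _ s t hs ht T => by exact norm_sum_upperEntry_le s t hs ht T) x y (fun T => ?_)
  · convert norm_upper_block_le z hK hz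
  · convert h T

end
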